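/- A triple (a, b, c) ∈ 𝒜 = {(a,b,c) ∈ (1/2)ℤ × (1/2)ℤ × ℤ : a + b ∈ ℤ} is equal to (A(P), (1/2)B(P), C(P)) of some unimodular lattice multi-polygon P if and only if a = b. -/

import Mathlib

open MeasureTheory

/-- The determinant of two vectors in `ℤ²`. -/
def det (p q : ℤ × ℤ) : ℤ := p.1 * q.2 - p.2 * q.1

/-- The dot product of two vectors in `ℤ²`. -/
def dot (p q : ℤ × ℤ) : ℤ := p.1 * q.1 + p.2 * q.2

/-- A lattice point regarded as a complex number. -/
noncomputable def toC (p : ℤ × ℤ) : ℂ := ⟨(p.1 : ℝ), (p.2 : ℝ)⟩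

/-- A lattice multi-polygon: a closed piecewise-linear loop `v` with vertices in
`ℤ²` and nondegenerate sides, together with a sign `ε i ∈ {±1}` on each side
`v_i v_{i+1}`, subject to the condition (⋆): whenever `v_{i-1}, v_i, v_{i+1}` are
collinear, the signs of the two adjacent sides agree if `v_i` lies between
`v_{i-1}` and `v_{i+1}` (the two side directions have positive dot product), and
differ if the loop reverses at `v_i` (negative dot product), i.e. if `v_{i-1}`
lies on `v_i v_{i+1}` or `v_{i+1}` lies on `v_{i-1} v_i`. -/
def IsMultiPolygon {d : ℕ} (v : ZMod d → ℤ × ℤ) (ε : ZMod d → ℤ) : Prop :=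
  (∀ i, ε i = 1 ∨ ε i = -1) ∧
  (∀ i, v i ≠ v (i + 1)) ∧
  (∀ i, det (v i - v (i - 1)) (v (i + 1) - v i) = 0 →
    (0 < dot (v i - v (i - 1)) (v (i + 1) - v i) → ε (i - 1) = ε i) ∧
    (dot (v i - v (i - 1)) (v (i + 1) - v i) < 0 → ε (i - 1) ≠ ε i))

/-- The winding number `d_P(x)` of the loop `v_1 → … → v_d → v_1` around a point
`x` of the plane (valid off the loop). -/
noncomputable def windingAt {d : ℕ} [NeZero d] (v : ZMod d → ℤ × ℤ) (x : ℂ) : ℝ :=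
  (2 * Real.pi)⁻¹ * ∑ i : ZMod d, Complex.arg ((toC (v (i + 1)) - x) / (toC (v i) - x))

/-- `A(P)`: the integral over the plane of the winding number of the loop. -/
noncomputable def polyA {d : ℕ} [NeZero d] (v : ZMod d → ℤ × ℤ) : ℝ :=
  ∫ x : ℂ, windingAt v x

/-- `B(P) = Σ ε_i |v_i v_{i+1}|`, where `|v_i v_{i+1}|` is the number of lattice
points on the side `v_i v_{i+1}` minus one, i.e. the gcd of the coordinate
differences. -/
def polyB {d : ℕ} [NeZero d] (v : ZMod d → ℤ × ℤ) (ε : ZMod d → ℤ) : ℤ :=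
  ∑ i : ZMod d, ε i * (Int.gcd ((v (i + 1)).1 - (v i).1) ((v (i + 1)).2 - (v i).2) : ℤ)

/-- The normal vector `n_i` to the side `v_i v_{i+1}`: the 90° (counterclockwise)
rotation of `ε_i n_i` points along `v_{i+1} − v_i`, so
`n_i = −i · ε_i · (v_{i+1} − v_i)` as a complex number. -/
noncomputable def normalVec {d : ℕ} (v : ZMod d → ℤ × ℤ) (ε : ZMod d → ℤ) (i : ZMod d) : ℂ :=
  -Complex.I * (ε i : ℂ) * (toC (v (i + 1)) - toC (v i))

/-- `C(P)`: the rotation number of the sequence of normal vectors `n_1, …, n_d`. -/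
noncomputable def polyC {d : ℕ} [NeZero d] (v : ZMod d → ℤ × ℤ) (ε : ZMod d → ℤ) : ℝ :=
  (2 * Real.pi)⁻¹ *
    ∑ i : ZMod d, Complex.arg (normalVec v ε (i + 1) / normalVec v ε i)

lemma sum_arg_aux (z1 z2 z3 : ℂ) (h : z1 * z2 * z3 = 1) :
    ∃ n : ℤ, z1.arg + z2.arg + z3.arg = n * (2 * Real.pi) := by
  have h1 : z1 ≠ 0 := by rintro rfl; simp at h
  have h2 : z2 ≠ 0 := by rintro rfl; simp at h
  have h3 : z3 ≠ 0 := by rintro rfl; simp at h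
  have key : ((z1.arg + z2.arg + z3.arg : ℝ) : Real.Angle) = 0 := by
    rw [Real.Angle.coe_add, Real.Angle.coe_add, ← Complex.arg_mul_coe_angle h1 h2,
      ← Complex.arg_mul_coe_angle (mul_ne_zero h1 h2) h3, h]
    simp
  obtain ⟨n, hn⟩ := (Real.Angle.coe_eq_zero_iff).1 key
  exact ⟨n, by rw [← hn]; simp⟩

lemma arg_pos_bd {z : ℂ} (h : 0 < z.im) : 0 < z.arg ∧ z.arg < Real.pi := by
  constructor
  · rcases lt_or_eq_of_le (Complex.arg_nonneg_iff.2 h.le) with h' | h'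
    · exact h'
    · have := (Complex.arg_eq_zero_iff.1 h'.symm).2
      linarith
  · exact Complex.arg_lt_pi_iff.2 (Or.inr h.ne')

lemma arg_neg_bd {z : ℂ} (h : z.im < 0) : -Real.pi < z.arg ∧ z.arg < 0 :=
  ⟨Complex.neg_pi_lt_arg z, Complex.arg_neg_iff.2 h⟩

lemma int_of_bd {n : ℤ} {l u : ℤ} (h1 : (l:ℝ) * Real.pi < n * (2 * Real.pi))
    (h2 : n * (2 * Real.pi) < (u:ℝ) * Real.pi) : l < 2 * n ∧ 2 * n < u := by
  have := Real.pi_pos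
  constructor
  · have : (l:ℝ) < 2 * n := by nlinarith
    exact_mod_cast this
  · have : 2 * (n:ℝ) < u := by nlinarith
    exact_mod_cast this

lemma sum_arg_pos {z1 z2 z3 : ℂ} (h : z1 * z2 * z3 = 1) (h1 : 0 < z1.im) (h2 : 0 < z2.im)
    (h3 : 0 < z3.im) : z1.arg + z2.arg + z3.arg = 2 * Real.pi := by
  obtain ⟨n, hn⟩ := sum_arg_aux z1 z2 z3 h
  have a1 := arg_pos_bd h1
  have a2 := arg_pos_bd h2
  have a3 := arg_pos_bd h3
  have := int_of_bd (n := n) (l := 0) (u := 3) (by push_cast; linarith) (by push_cast; linarith)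
  have : n = 1 := by omega
  subst this
  rw [hn]; simp

lemma sum_arg_neg {z1 z2 z3 : ℂ} (h : z1 * z2 * z3 = 1) (h1 : z1.im < 0) (h2 : z2.im < 0)
    (h3 : z3.im < 0) : z1.arg + z2.arg + z3.arg = -(2 * Real.pi) := by
  obtain ⟨n, hn⟩ := sum_arg_aux z1 z2 z3 h
  have a1 := arg_neg_bd h1
  have a2 := arg_neg_bd h2
  have a3 := arg_neg_bd h3
  have := int_of_bd (n := n) (l := -3) (u := 0) (by push_cast; linarith) (by push_cast; linarith)
  have : n = -1 := by omega
  subst this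
  rw [hn]; simp

lemma sum_arg_mixed {z1 z2 z3 : ℂ} (h : z1 * z2 * z3 = 1) (h1 : z1.im ≠ 0) (h2 : z2.im ≠ 0)
    (h3 : z3.im ≠ 0) (hp : ¬ (0 < z1.im ∧ 0 < z2.im ∧ 0 < z3.im))
    (hn : ¬ (z1.im < 0 ∧ z2.im < 0 ∧ z3.im < 0)) : z1.arg + z2.arg + z3.arg = 0 := by
  obtain ⟨n, hn'⟩ := sum_arg_aux z1 z2 z3 h
  have hpi := Real.pi_pos
  have : -2 < 2 * n ∧ 2 * n < 2 := by
    have b1 := Complex.neg_pi_lt_arg z1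
    have b2 := Complex.neg_pi_lt_arg z2
    have b3 := Complex.neg_pi_lt_arg z3
    have c1 := Complex.arg_le_pi z1
    have c2 := Complex.arg_le_pi z2
    have c3 := Complex.arg_le_pi z3
    apply int_of_bd
    · push_cast
      rw [← hn']
      have : 0 < z1.im ∨ 0 < z2.im ∨ 0 < z3.im := by
        by_contra! hc
        exact hn ⟨lt_of_le_of_ne hc.1 h1, lt_of_le_of_ne hc.2.1 h2, lt_of_le_of_ne hc.2.2 h3⟩
      rcases this with g | g | g <;> have a := arg_pos_bd g <;> linarith [a.1]
    · push_cast
      rw [← hn']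
      have : z1.im < 0 ∨ z2.im < 0 ∨ z3.im < 0 := by
        by_contra! hc
        exact hp ⟨lt_of_le_of_ne hc.1 h1.symm, lt_of_le_of_ne hc.2.1 h2.symm,
          lt_of_le_of_ne hc.2.2 h3.symm⟩
      rcases this with g | g | g <;> have a := arg_neg_bd g <;> linarith [a.2]
  have : n = 0 := by omega
  subst this
  rw [hn']; simp

lemma div_im' (p q : ℂ) : (q / p).im = (p.re * q.im - p.im * q.re) / Complex.normSq p := by
  rw [Complex.div_im]; ring

/-- the barycentric coordinate map -/
noncomputable def fmap (a b : ℤ × ℤ) : ℂ →ₗ[ℝ] ℂ where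
  toFun x := ⟨(det a b : ℝ) * (x.re * b.2 - x.im * b.1), (det a b : ℝ) * (a.1 * x.im - a.2 * x.re)⟩
  map_add' x y := by apply Complex.ext <;> simp <;> ring
  map_smul' r x := by apply Complex.ext <;> simp <;> ring

lemma fmap_det (a b : ℤ × ℤ) (h : det a b = 1 ∨ det a b = -1) :
    LinearMap.det (fmap a b) = (det a b : ℝ) := by
  rw [← LinearMap.det_toMatrix Complex.basisOneI, Matrix.det_fin_two]
  simp only [LinearMap.toMatrix_apply, Complex.coe_basisOneI, Complex.coe_basisOneI_repr, fmap]
  have : (det a b : ℝ) = a.1 * b.2 - a.2 * b.1 := by simp [det]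
  have h2 : (det a b : ℝ) * (det a b : ℝ) = 1 := by rcases h with h | h <;> rw [h] <;> simp
  simp
  rw [this] at *
  linear_combination (( a.1 * b.2 - a.2 * b.1 : ℝ)) * h2

def stdT : Set ℂ := {z | 0 < z.re ∧ 0 < z.im ∧ 0 < 1 - z.re - z.im}
def bad : Set ℂ := {z | z.re = 0 ∨ z.im = 0 ∨ 1 - z.re - z.im = 0}

lemma stdT_vol : volume stdT = ENNReal.ofReal (1/2) := by
  have := (Complex.volume_preserving_equiv_real_prod).measure_preimage_equiv
    (regionBetween (fun _ : ℝ => (0:ℝ)) (fun x => 1 - x) (Set.Ioo 0 1))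
  have e : stdT = Complex.measurableEquivRealProd ⁻¹'
    (regionBetween (fun _ : ℝ => (0:ℝ)) (fun x => 1 - x) (Set.Ioo 0 1)) := by
    ext z
    change (0 < z.re ∧ 0 < z.im ∧ 0 < 1 - z.re - z.im) ↔
      (0 < z.re ∧ z.re < 1) ∧ (0 < z.im ∧ z.im < 1 - z.re)
    constructor
    · rintro ⟨h1, h2, h3⟩
      refine ⟨⟨h1, by linarith⟩, h2, by linarith⟩
    · rintro ⟨⟨h1, h4⟩, h2, h3⟩
      exact ⟨h1, h2, by linarith⟩
  rw [e, this, Measure.volume_eq_prod, volume_regionBetween_eq_integral]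
  · congr 1
    rw [← integral_Ioc_eq_integral_Ioo, ← intervalIntegral.integral_of_le (by norm_num)]
    simp only [Pi.sub_apply, sub_zero]
    rw [intervalIntegral.integral_sub (by simp) (by simp)]
    simp
    norm_num
  · exact integrableOn_const (by simp)
  · exact (Continuous.integrableOn_Icc (by fun_prop)).mono_set Set.Ioo_subset_Icc_self
  · exact measurableSet_Ioo
  · intro x hx; simp at hx ⊢; linarith

lemma stdT_meas : MeasurableSet stdT := by
  apply IsOpen.measurableSet
  change IsOpen ({z : ℂ | 0 < z.re} ∩ ({z : ℂ | 0 < z.im} ∩ {z : ℂ | 0 < 1 - z.re - z.im}))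
  apply IsOpen.inter (isOpen_lt (by fun_prop) (by fun_prop))
  exact IsOpen.inter (isOpen_lt (by fun_prop) (by fun_prop)) (isOpen_lt (by fun_prop) (by fun_prop))

lemma line_null (p q r : ℝ) (h : ∃ z : ℂ, p * z.re + q * z.im ≠ r) :
    volume {z : ℂ | p * z.re + q * z.im = r} = 0 := by
  let S : AffineSubspace ℝ ℂ :=
    { carrier := {z : ℂ | p * z.re + q * z.im = r}
      smul_vsub_vadd_mem' := by
        intro c x y z hx hy hz
        simp at *
        linear_combination c * hx - c * hy + hz }
  apply Measure.addHaar_affineSubspace volume S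
  intro hS
  obtain ⟨z, hz⟩ := h
  have : z ∈ S := by rw [hS]; trivial
  exact hz this

lemma bad_null : volume bad = 0 := by
  have e : bad ⊆ {z : ℂ | 1 * z.re + 0 * z.im = 0} ∪ ({z : ℂ | 0 * z.re + 1 * z.im = 0} ∪
    {z : ℂ | 1 * z.re + 1 * z.im = 1}) := by
    intro z hz
    rcases hz with h | h | h
    · left; simp [h]
    · right; left; simp [h]
    · right; right; simp; linarith
  refine measure_mono_null e ?_
  rw [measure_union_null_iff, measure_union_null_iff]
  exact ⟨line_null _ _ _ ⟨1, by simp⟩, line_null _ _ _ ⟨Complex.I, by simp⟩,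
    line_null _ _ _ ⟨0, by simp⟩⟩

lemma fmap_preimage (a b : ℤ × ℤ) (h : det a b = 1 ∨ det a b = -1) (s : Set ℂ) :
    volume (fmap a b ⁻¹' s) = volume s := by
  have hd := fmap_det a b h
  rw [Measure.addHaar_preimage_linearMap]
  · rw [hd]; rcases h with h | h <;> simp [h]
  · rw [hd]; rcases h with h | h <;> simp [h]

noncomputable def tri (a b : ℤ × ℤ) (x : ℂ) : ℝ :=
  Complex.arg ((toC a - x) / (0 - x)) + Complex.arg ((toC b - x) / (toC a - x)) +
    Complex.arg ((0 - x) / (toC b - x))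

lemma ae_good (a b : ℤ × ℤ) (h : det a b = 1 ∨ det a b = -1) :
    ∀ᵐ x : ℂ, fmap a b x ∉ bad := by
  rw [ae_iff]
  simp only [not_not]
  exact (fmap_preimage a b h bad).trans bad_null

lemma tri_eq (a b : ℤ × ℤ) (h : det a b = 1 ∨ det a b = -1) (x : ℂ) (hx : fmap a b x ∉ bad) :
    tri a b x = (fmap a b ⁻¹' stdT).indicator (fun _ => 2 * Real.pi * (det a b : ℝ)) x ∧
    Complex.arg ((0 - x) / (toC b - x)) = - Complex.arg ((toC b - x) / (0 - x)) := by
  have hdet : (det a b : ℝ) = a.1 * b.2 - a.2 * b.1 := by simp [det]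
  obtain ⟨s, hs⟩ : ∃ s, s = (fmap a b x).re := ⟨_, rfl⟩
  obtain ⟨t, ht⟩ : ∃ t, t = (fmap a b x).im := ⟨_, rfl⟩
  have hs' : s = (det a b : ℝ) * (x.re * b.2 - x.im * b.1) := hs
  have ht' : t = (det a b : ℝ) * (a.1 * x.im - a.2 * x.re) := ht
  have hm : x ∈ fmap a b ⁻¹' stdT ↔ 0 < s ∧ 0 < t ∧ 0 < 1 - s - t := by
    rw [hs, ht]; rfl
  have hb : s ≠ 0 ∧ t ≠ 0 ∧ 1 - s - t ≠ 0 := by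
    rw [hs, ht]; simpa [bad] using hx
  obtain ⟨hb1, hb2, hb3⟩ := hb
  set p : ℂ := 0 - x with hp
  set q : ℂ := toC a - x with hq
  set r : ℂ := toC b - x with hr
  have e2 : (det a b : ℝ) * (det a b : ℝ) = 1 := by rcases h with h | h <;> rw [h] <;> simp
  have d1 : p.re * q.im - p.im * q.re = (det a b : ℝ) * t := by
    rw [ht', ← mul_assoc, e2]; simp [hp, hq, toC]; ring
  have d3 : r.re * p.im - r.im * p.re = (det a b : ℝ) * s := by
    rw [hs', ← mul_assoc, e2]; simp [hp, hr, toC]; ring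
  have d2 : q.re * r.im - q.im * r.re = (det a b : ℝ) * (1 - s - t) := by
    have : (det a b : ℝ) * (1 - s - t) = det a b - det a b * t - det a b * s := by ring
    rw [this, ← d1, ← d3, hdet]; simp [hp, hq, hr, toC]; ring
  have ed : (det a b : ℝ) ≠ 0 := by rcases h with h | h <;> rw [h] <;> simp
  have p0 : p ≠ 0 := by
    intro h0; rw [h0] at d1; simp at d1
    rcases d1 with h' | h' 
    · exact ed (by exact_mod_cast h')
    · exact hb2 h'
  have r0 : r ≠ 0 := by
    intro h0; rw [h0] at d3; simp at d3
    rcases d3 with h' | h' 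
    · exact ed (by exact_mod_cast h')
    · exact hb1 h'
  have q0 : q ≠ 0 := by
    intro h0; rw [h0] at d1; simp at d1
    rcases d1 with h' | h' 
    · exact ed (by exact_mod_cast h')
    · exact hb2 h'
  have i1 : (q / p).im = (det a b : ℝ) * t / Complex.normSq p := by rw [div_im', d1]
  have i2 : (r / q).im = (det a b : ℝ) * (1 - s - t) / Complex.normSq q := by rw [div_im', d2]
  have i3 : (p / r).im = (det a b : ℝ) * s / Complex.normSq r := by rw [div_im', d3]
  have np := Complex.normSq_pos.2 p0
  have nq := Complex.normSq_pos.2 q0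
  have nr := Complex.normSq_pos.2 r0
  have hprod : q / p * (r / q) * (p / r) = 1 := by field_simp
  constructor
  · change (q/p).arg + (r/q).arg + (p/r).arg = _
    have n1 : (q/p).im ≠ 0 := by rw [i1]; positivity
    have n2 : (r/q).im ≠ 0 := by rw [i2]; positivity
    have n3 : (p/r).im ≠ 0 := by rw [i3]; positivity
    by_cases hx' : x ∈ fmap a b ⁻¹' stdT
    · rw [Set.indicator_of_mem hx']
      obtain ⟨g1, g2, g3⟩ := hm.1 hx'
      rcases h with h | h
      · rw [h] at i1 i2 i3 ⊢
        rw [sum_arg_pos hprod]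
        · simp
        · rw [i1]; simp; positivity
        · rw [i2]; push_cast; positivity
        · rw [i3]; simp; positivity
      · rw [h] at i1 i2 i3 ⊢
        rw [sum_arg_neg hprod]
        · simp
        · rw [i1]; apply div_neg_of_neg_of_pos _ np; simp; linarith
        · rw [i2]; apply div_neg_of_neg_of_pos _ nq; push_cast; linarith
        · rw [i3]; apply div_neg_of_neg_of_pos _ nr; simp; linarith
    · rw [Set.indicator_of_notMem hx']
      rw [hm] at hx'
      apply sum_arg_mixed hprod n1 n2 n3 <;> rw [i1, i2, i3]
      · simp only [div_pos_iff_of_pos_right np, div_pos_iff_of_pos_right nq, div_pos_iff_of_pos_right nr]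
        rcases h with h | h <;> rw [h] <;> push_cast
        · rintro ⟨h1, h2, h3⟩
          exact hx' ⟨by linarith, by linarith, by linarith⟩
        · rintro ⟨h1, h2, h3⟩
          linarith
      · simp only [div_lt_iff₀ np, div_lt_iff₀ nq, div_lt_iff₀ nr, zero_mul]
        rcases h with h | h <;> rw [h] <;> push_cast
        · rintro ⟨h1, h2, h3⟩
          linarith
        · rintro ⟨h1, h2, h3⟩
          exact hx' ⟨by linarith, by linarith, by linarith⟩
  · rw [← inv_div r p, Complex.arg_inv, if_neg]
    intro hpi
    have := (Complex.arg_eq_pi_iff.1 hpi).2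
    rw [div_im'] at this
    have h4 : p.re * r.im - p.im * r.re = 0 := by
      rcases div_eq_zero_iff.1 this with h' | h'
      · exact h'
      · exact absurd h' np.ne'
    have : (det a b : ℝ) * s = 0 := by rw [← d3]; linarith
    exact (mul_ne_zero ed hb1) this

lemma tri_vol (a b : ℤ × ℤ) (h : det a b = 1 ∨ det a b = -1) :
    volume (fmap a b ⁻¹' stdT) = ENNReal.ofReal (1/2) := by
  rw [fmap_preimage a b h, stdT_vol]

lemma fmap_meas (a b : ℤ × ℤ) : MeasurableSet (fmap a b ⁻¹' stdT) :=
  stdT_meas.preimage (fmap a b).continuous_of_finiteDimensional.measurable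

lemma polyA_eq {d : ℕ} [NeZero d] (v : ZMod d → ℤ × ℤ)
    (h : ∀ i, det (v i) (v (i + 1)) = 1 ∨ det (v i) (v (i + 1)) = -1) :
    polyA v = ((∑ i, det (v i) (v (i + 1)) : ℤ) : ℝ) / 2 := by
  have key : ∀ᵐ x : ℂ, windingAt v x = ∑ i : ZMod d,
      (fmap (v i) (v (i+1)) ⁻¹' stdT).indicator (fun _ => (det (v i) (v (i+1)) : ℝ)) x := by
    have hall : ∀ᵐ x : ℂ, ∀ i, fmap (v i) (v (i+1)) x ∉ bad :=
      ae_all_iff.2 fun i => ae_good _ _ (h i)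
    filter_upwards [hall] with x hx
    have hs : ∑ i : ZMod d, Complex.arg ((toC (v (i + 1)) - x) / (toC (v i) - x)) =
        ∑ i : ZMod d, tri (v i) (v (i+1)) x := by
      have : ∀ i, tri (v i) (v (i+1)) x = Complex.arg ((toC (v (i + 1)) - x) / (toC (v i) - x)) +
          (Complex.arg ((toC (v i) - x) / (0 - x)) -
            Complex.arg ((toC (v (i + 1)) - x) / (0 - x))) := by
        intro i
        rw [tri, (tri_eq _ _ (h i) x (hx i)).2]; ring
      simp_rw [this]
      have e := Equiv.sum_comp (Equiv.addRight (1 : ZMod d))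
          (fun i => Complex.arg ((toC (v i) - x) / (0 - x)))
      simp only [Equiv.coe_addRight] at e
      rw [Finset.sum_add_distrib, Finset.sum_sub_distrib, e, sub_self, add_zero]
    rw [windingAt, hs, Finset.mul_sum]
    refine Finset.sum_congr rfl fun i _ => ?_
    rw [(tri_eq _ _ (h i) x (hx i)).1]
    by_cases hm : x ∈ fmap (v i) (v (i+1)) ⁻¹' stdT
    · rw [Set.indicator_of_mem hm, Set.indicator_of_mem hm]
      have := Real.pi_pos
      field_simp
    · rw [Set.indicator_of_notMem hm, Set.indicator_of_notMem hm]; simp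
  rw [polyA, integral_congr_ae key, integral_finsetSum]
  · push_cast
    rw [Finset.sum_div]
    refine Finset.sum_congr rfl fun i _ => ?_
    rw [integral_indicator_const _ (fmap_meas _ _), Measure.real, tri_vol _ _ (h i)]
    rw [ENNReal.toReal_ofReal (by norm_num)]
    simp; ring
  · intro i _
    rw [integrable_indicator_iff (fmap_meas _ _)]
    exact integrableOn_const (by rw [tri_vol _ _ (h i)]; exact ENNReal.ofReal_ne_top)

lemma polyB_eq {d : ℕ} [NeZero d] (v : ZMod d → ℤ × ℤ)
    (h : ∀ i, det (v i) (v (i + 1)) = 1 ∨ det (v i) (v (i + 1)) = -1) :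
    polyB v (fun i => det (v i) (v (i + 1))) = ∑ i, det (v i) (v (i + 1)) := by
  refine Finset.sum_congr rfl fun i _ => ?_
  have hg : (Int.gcd ((v (i + 1)).1 - (v i).1) ((v (i + 1)).2 - (v i).2) : ℤ) = 1 := by
    set g := Int.gcd ((v (i + 1)).1 - (v i).1) ((v (i + 1)).2 - (v i).2) with hg
    have h1 : (g : ℤ) ∣ (v (i + 1)).1 - (v i).1 := Int.gcd_dvd_left ..
    have h2 : (g : ℤ) ∣ (v (i + 1)).2 - (v i).2 := Int.gcd_dvd_right ..
    have h3 : (g : ℤ) ∣ det (v i) (v (i + 1)) := by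
      have : det (v i) (v (i + 1)) = (v i).1 * ((v (i + 1)).2 - (v i).2) -
        (v i).2 * ((v (i + 1)).1 - (v i).1) := by simp [det]; ring
      rw [this]
      exact dvd_sub (h2.mul_left _) (h1.mul_left _)
    have h4 : (g : ℤ) ∣ 1 := by
      rcases h i with h' | h' <;> rw [h'] at h3
      · exact h3
      · simpa using h3
    have := Int.eq_one_of_dvd_one (by positivity) h4
    exact this
  simp only [hg, mul_one]

noncomputable def nv (p q : ℤ × ℤ) : ℂ := -Complex.I * (det p q : ℂ) * (toC q - toC p)

def Good (m c : ℤ) : Prop := ∃ (d : ℕ) (w : ℕ → ℤ × ℤ), 0 < d ∧ w 0 = (1,0) ∧ w 1 = (0,1) ∧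
  w d = (1,0) ∧ w (d+1) = (0,1) ∧
  (∀ i < d, det (w i) (w (i+1)) = 1 ∨ det (w i) (w (i+1)) = -1) ∧
  ∑ i ∈ Finset.range d, det (w i) (w (i+1)) = m ∧
  ∑ i ∈ Finset.range d, Complex.arg (nv (w (i+1)) (w (i+2)) / nv (w i) (w (i+1))) =
    2 * Real.pi * c

lemma Good.add {m c m' c' : ℤ} (h : Good m c) (h' : Good m' c') : Good (m + m') (c + c') := by
  obtain ⟨d, w, hd, h0, h1, h2, h3, h4, h5, h6⟩ := h
  obtain ⟨d', w', hd', h0', h1', h2', h3', h4', h5', h6'⟩ := h'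
  let u : ℕ → ℤ × ℤ := fun i => if i < d then w i else w' (i - d)
  have uw : ∀ i, i ≤ d + 1 → u i = w i := by
    intro i hi
    by_cases hlt : i < d
    · simp [u, hlt]
    · have : i = d ∨ i = d + 1 := by omega
      rcases this with rfl | rfl
      · simp [u, h0', h2]
      · simp [u, h1', h3]
  have uw' : ∀ i, u (d + i) = w' i := by intro i; simp [u]
  refine ⟨d + d', u, by omega, ?_, ?_, ?_, ?_, ?_, ?_, ?_⟩
  · rw [uw 0 (by omega), h0]
  · rw [uw 1 (by omega), h1]
  · rw [uw', h2']
  · rw [add_assoc, uw', h3']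
  · intro i hi
    by_cases hlt : i < d
    · rw [uw i (by omega), uw (i+1) (by omega)]; exact h4 i hlt
    · obtain ⟨j, rfl⟩ : ∃ j, i = d + j := ⟨i - d, by omega⟩
      rw [add_assoc, uw', uw']; exact h4' j (by omega)
  · rw [Finset.sum_range_add, ← h5, ← h5']
    congr 1
    · refine Finset.sum_congr rfl fun i hi => ?_
      have := Finset.mem_range.1 hi
      rw [uw i (by omega), uw (i+1) (by omega)]
    · refine Finset.sum_congr rfl fun i hi => ?_
      rw [add_assoc, uw', uw']
  · rw [Finset.sum_range_add]
    push_cast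
    rw [mul_add, ← h6, ← h6']
    congr 1
    · refine Finset.sum_congr rfl fun i hi => ?_
      have := Finset.mem_range.1 hi
      rw [uw i (by omega), uw (i+1) (by omega), uw (i+2) (by omega)]
    · refine Finset.sum_congr rfl fun i hi => ?_
      rw [add_assoc, add_assoc, uw', uw', uw']

lemma good41 : Good 4 1 := by
  refine ⟨4, fun i => ([(1,0),(0,1),(-1,0),(0,-1),(1,0),(0,1)] : List (ℤ × ℤ)).getD i 0,
    by norm_num, rfl, rfl, rfl, rfl, by decide, by decide, ?_⟩
  have e1 : nv (0,1) (-1,0) / nv (1,0) (0,1) = Complex.I := by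
    have : nv (1,0) (0,1) ≠ 0 := by intro h; simpa [nv, det, toC] using congrArg Complex.re h
    rw [div_eq_iff this]; apply Complex.ext <;> simp [nv, det, toC]
  have e2 : nv (-1,0) (0,-1) / nv (0,1) (-1,0) = Complex.I := by
    have : nv (0,1) (-1,0) ≠ 0 := by intro h; simpa [nv, det, toC] using congrArg Complex.re h
    rw [div_eq_iff this]; apply Complex.ext <;> simp [nv, det, toC]
  have e3 : nv (0,-1) (1,0) / nv (-1,0) (0,-1) = Complex.I := by
    have : nv (-1,0) (0,-1) ≠ 0 := by intro h; simpa [nv, det, toC] using congrArg Complex.re h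
    rw [div_eq_iff this]; apply Complex.ext <;> simp [nv, det, toC]
  have e4 : nv (1,0) (0,1) / nv (0,-1) (1,0) = Complex.I := by
    have : nv (0,-1) (1,0) ≠ 0 := by intro h; simpa [nv, det, toC] using congrArg Complex.re h
    rw [div_eq_iff this]; apply Complex.ext <;> simp [nv, det, toC]
  simp [Finset.sum_range_succ, e1, e2, e3, e4]
  ring

lemma good41' : Good (-4) (-1) := by
  refine ⟨6, fun i => ([(1,0),(0,1),(1,0),(0,-1),(-1,0),(0,1),(1,0),(0,1)] : List (ℤ × ℤ)).getD i 0,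
    by norm_num, rfl, rfl, rfl, rfl, by decide, by decide, ?_⟩
  have e0 : nv (0,1) (1,0) / nv (1,0) (0,1) = 1 := by
    have : nv (1,0) (0,1) ≠ 0 := by intro h; simpa [nv, det, toC] using congrArg Complex.re h
    rw [div_eq_iff this]; apply Complex.ext <;> simp [nv, det, toC]
  have e1 : nv (1,0) (0,-1) / nv (0,1) (1,0) = -Complex.I := by
    have : nv (0,1) (1,0) ≠ 0 := by intro h; simpa [nv, det, toC] using congrArg Complex.re h
    rw [div_eq_iff this]; apply Complex.ext <;> simp [nv, det, toC]
  have e2 : nv (0,-1) (-1,0) / nv (1,0) (0,-1) = -Complex.I := by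
    have : nv (1,0) (0,-1) ≠ 0 := by intro h; simpa [nv, det, toC] using congrArg Complex.re h
    rw [div_eq_iff this]; apply Complex.ext <;> simp [nv, det, toC]
  have e3 : nv (-1,0) (0,1) / nv (0,-1) (-1,0) = -Complex.I := by
    have : nv (0,-1) (-1,0) ≠ 0 := by intro h; simpa [nv, det, toC] using congrArg Complex.re h
    rw [div_eq_iff this]; apply Complex.ext <;> simp [nv, det, toC]
  have e4 : nv (0,1) (1,0) / nv (-1,0) (0,1) = -Complex.I := by
    have : nv (-1,0) (0,1) ≠ 0 := by intro h; simpa [nv, det, toC] using congrArg Complex.re h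
    rw [div_eq_iff this]; apply Complex.ext <;> simp [nv, det, toC]
  have e5 : nv (1,0) (0,1) / nv (0,1) (1,0) = 1 := by
    have : nv (0,1) (1,0) ≠ 0 := by intro h; simpa [nv, det, toC] using congrArg Complex.re h
    rw [div_eq_iff this]; apply Complex.ext <;> simp [nv, det, toC]
  simp [Finset.sum_range_succ, e0, e1, e2, e3, e4, e5]
  ring

lemma good31 : Good 3 1 := by
  refine ⟨3, fun i => ([(1,0),(0,1),(-1,-1),(1,0),(0,1)] : List (ℤ × ℤ)).getD i 0,
    by norm_num, rfl, rfl, rfl, rfl, by decide, by decide, ?_⟩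
  have n1 : nv (1,0) (0,1) ≠ 0 := by intro h; simpa [nv, det, toC] using congrArg Complex.re h
  have n2 : nv (0,1) (-1,-1) ≠ 0 := by intro h; simpa [nv, det, toC] using congrArg Complex.im h
  have n3 : nv (-1,-1) (1,0) ≠ 0 := by intro h; simpa [nv, det, toC] using congrArg Complex.re h
  have key := sum_arg_pos (z1 := nv (0,1) (-1,-1) / nv (1,0) (0,1))
    (z2 := nv (-1,-1) (1,0) / nv (0,1) (-1,-1)) (z3 := nv (1,0) (0,1) / nv (-1,-1) (1,0))
    (by field_simp)
    (by rw [div_im']; refine div_pos ?_ (Complex.normSq_pos.2 n1); simp [nv, det, toC]; try norm_num)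
    (by rw [div_im']; refine div_pos ?_ (Complex.normSq_pos.2 n2); simp [nv, det, toC]; try norm_num)
    (by rw [div_im']; refine div_pos ?_ (Complex.normSq_pos.2 n3); simp [nv, det, toC]; try norm_num)
  simpa [Finset.sum_range_succ] using key

lemma good31' : Good (-3) (-1) := by
  refine ⟨5, fun i => ([(1,0),(0,1),(1,0),(-1,-1),(0,1),(1,0),(0,1)] : List (ℤ × ℤ)).getD i 0,
    by norm_num, rfl, rfl, rfl, rfl, by decide, by decide, ?_⟩
  have n0 : nv (1,0) (0,1) ≠ 0 := by intro h; simpa [nv, det, toC] using congrArg Complex.re h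
  have n1 : nv (0,1) (1,0) ≠ 0 := by intro h; simpa [nv, det, toC] using congrArg Complex.re h
  have n2 : nv (1,0) (-1,-1) ≠ 0 := by intro h; simpa [nv, det, toC] using congrArg Complex.re h
  have n3 : nv (-1,-1) (0,1) ≠ 0 := by intro h; simpa [nv, det, toC] using congrArg Complex.im h
  have e0 : nv (0,1) (1,0) / nv (1,0) (0,1) = 1 := by
    rw [div_eq_iff n0]; apply Complex.ext <;> simp [nv, det, toC]
  have e5 : nv (1,0) (0,1) / nv (0,1) (1,0) = 1 := by
    rw [div_eq_iff n1]; apply Complex.ext <;> simp [nv, det, toC]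
  have key := sum_arg_neg (z1 := nv (1,0) (-1,-1) / nv (0,1) (1,0))
    (z2 := nv (-1,-1) (0,1) / nv (1,0) (-1,-1)) (z3 := nv (0,1) (1,0) / nv (-1,-1) (0,1))
    (by field_simp)
    (by rw [div_im']; refine div_neg_of_neg_of_pos ?_ (Complex.normSq_pos.2 n1); simp [nv, det, toC]; try norm_num)
    (by rw [div_im']; refine div_neg_of_neg_of_pos ?_ (Complex.normSq_pos.2 n2); simp [nv, det, toC]; try norm_num)
    (by rw [div_im']; refine div_neg_of_neg_of_pos ?_ (Complex.normSq_pos.2 n3); simp [nv, det, toC]; try norm_num)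
  simpa [Finset.sum_range_succ, e0, e5] using key

lemma good10 : Good 1 0 := by simpa using good41.add good31'
lemma good10' : Good (-1) 0 := by simpa using good41'.add good31
lemma good00 : Good 0 0 := by simpa using good10.add good10'

lemma good_m0 (m : ℤ) : Good m 0 := by
  induction m using Int.induction_on with
  | zero => exact good00
  | succ n ih => simpa using ih.add good10
  | pred n ih => simpa [sub_eq_add_neg] using ih.add good10'

lemma good_all (c : ℤ) : ∀ m : ℤ, Good m c := by
  induction c using Int.induction_on with
  | zero => exact good_m0
  | succ n ih => intro m; simpa using (ih (m - 4)).add good41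
  | pred n ih => intro m; simpa [sub_eq_add_neg] using (ih (m + 4)).add good41'

lemma exists_of_good {m c : ℤ} (h : Good m c) :
    ∃ (d : ℕ) (_ : NeZero d) (v : ZMod d → ℤ × ℤ),
        (∀ i, det (v i) (v (i + 1)) = 1 ∨ det (v i) (v (i + 1)) = -1) ∧
        ∑ i, det (v i) (v (i + 1)) = m ∧
        polyC v (fun i => det (v i) (v (i + 1))) = c := by
  obtain ⟨d, w, hd, h0, h1, h2, h3, h4, h5, h6⟩ := h
  obtain ⟨k, rfl⟩ : ∃ k, d = k + 1 := ⟨d - 1, by omega⟩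
  have hk : 0 < k := by
    rcases Nat.eq_zero_or_pos k with rfl | h
    · simp [h1] at h2
    · exact h
  let v : Fin (k+1) → ℤ × ℤ := fun i => w i.val
  have s1 : ∀ i : Fin (k+1), v (i+1) = w (i.val + 1) := by
    intro i
    by_cases hi : i.val = k
    · have : i = Fin.last k := Fin.ext hi
      subst this
      simp [v, h0, h2]
    · have : i < Fin.last k := by
        rw [Fin.lt_def]; have := i.2; simp; omega
      simp only [v, Fin.val_add_one_of_lt this]
  have s2 : ∀ i : Fin (k+1), v (i+1+1) = w (i.val + 2) := by
    intro i
    rw [s1]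
    by_cases hi : i.val = k
    · have : i = Fin.last k := Fin.ext hi
      subst this
      simp [h1, ← h3]
    · have : i < Fin.last k := by
        rw [Fin.lt_def]; have := i.2; simp; omega
      rw [Fin.val_add_one_of_lt this]
  refine ⟨k+1, inferInstance, v, ?_, ?_, ?_⟩
  · change ∀ i : Fin (k+1), det (v i) (v (i + 1)) = 1 ∨ det (v i) (v (i + 1)) = -1
    intro i
    have := h4 i.val i.2
    rw [← s1 i] at this
    exact this
  · rw [← h5, ← Fin.sum_univ_eq_sum_range (fun i => det (w i) (w (i+1)))]
    refine Finset.sum_congr rfl fun i _ => ?_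
    rw [← s1 i]; rfl
  · have : ∑ i : Fin (k+1), Complex.arg (nv (v (i+1)) (v (i+1+1)) / nv (v i) (v (i+1))) =
        2 * Real.pi * c := by
      rw [← h6, ← Fin.sum_univ_eq_sum_range
        (fun i => Complex.arg (nv (w (i+1)) (w (i+2)) / nv (w i) (w (i+1))))]
      refine Finset.sum_congr rfl fun i _ => ?_
      rw [← s1 i, ← s2 i]
    have e : polyC (d := k+1) v (fun i : Fin (k+1) => det (v i) (v (i + 1))) = (2 * Real.pi)⁻¹ * 
      ∑ i : Fin (k+1), Complex.arg (nv (v (i+1)) (v (i+1+1)) / nv (v i) (v (i+1))) := rfl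
    refine e.trans ?_
    rw [this]
    have := Real.pi_pos
    field_simp

/-- a triple `(a, b, c) ∈ 𝒜` is equal to `(A(P), ½B(P), C(P))` of
some unimodular lattice multi-polygon `P` (a unimodular sequence `v` with signs
`ε_i = det(v_i, v_{i+1})`) if and only if `a = b`. -/
theorem stmt15 (a b : ℝ) (c : ℤ)
    (hA1 : ∃ m : ℤ, a = m / 2) (hA2 : ∃ m : ℤ, b = m / 2)
    (hA3 : ∃ m : ℤ, a + b = m) :
    (∃ (d : ℕ) (_ : NeZero d) (v : ZMod d → ℤ × ℤ),
        (∀ i, det (v i) (v (i + 1)) = 1 ∨ det (v i) (v (i + 1)) = -1) ∧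
        polyA v = a ∧
        (polyB v (fun i => det (v i) (v (i + 1))) : ℝ) / 2 = b ∧
        polyC v (fun i => det (v i) (v (i + 1))) = c)
      ↔ a = b := by
  constructor
  · rintro ⟨d, _, v, h, ha, hb, -⟩
    rw [← ha, ← hb, polyA_eq v h, polyB_eq v h]
  · rintro rfl
    obtain ⟨m, rfl⟩ := hA1
    obtain ⟨d, i, v, h, hm, hc⟩ := exists_of_good (good_all c m)
    refine ⟨d, i, v, h, ?_, ?_, hc⟩
    · rw [polyA_eq v h, hm]
    · rw [polyB_eq v h, hm]
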